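/- Let k ≥ 1, let ε ≥ 0 satisfy ν e_j ≤ ε for all 1 ≤ j ≤ k, and assume the double series Σ_{i=0}^∞ Σ_{j=0}^∞ γ^{i+jm} c(i+(j+1)m) converges. Then μ(v_{π*} − v_{k,m}) ≤ (Σ_{i=0}^{k−1} γ^i c_{π*}(i)) ε + γ^m (Σ_{i,j≥0} γ^{i+jm} c(i+(j+1)m)) ε + 2 γ^k Vmax; in terms of the constants C^{(1)}_{π*} = (1−γ)Σ_{i≥0}γ^i c_{π*}(i) and C^{(2,m,m)} = (1−γ)(1−γ^m)Σ_{i,j≥0}γ^{i+jm}c(i+jm+m), this gives μ(v_{π*} − v_{k,m}) ≤ (C^{(1)}_{π*}/(1−γ) + γ^m C^{(2,m,m)}/((1−γ)(1−γ^m))) ε + 2 γ^k Vmax. -/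

import Mathlib

open Finset Matrix

noncomputable section

/-- Transition matrix of a deterministic stationary policy. -/
def polMat {S A : Type*} (P : S → A → S → ℝ) (π : S → A) : Matrix S S ℝ :=
  Matrix.of fun s s' => P s (π s) s'

/-- Bellman operator `T_π v = r + γ P_π v` of a deterministic stationary policy. -/
def bOp {S A : Type*} [Fintype S] (P : S → A → S → ℝ) (γ : ℝ) (r : S → ℝ)
    (π : S → A) (v : S → ℝ) : S → ℝ :=
  fun s => r s + γ * ∑ s' : S, P s (π s) s' * v s'

/-- `errOf P γ r v π = max_{π'} T_{π'} v − T_π v` (componentwise maximum over all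
deterministic stationary policies `π'`). -/
def errOf {S A : Type*} [Fintype S] [Fintype A] [DecidableEq S] [Nonempty A]
    (P : S → A → S → ℝ) (γ : ℝ) (r : S → ℝ) (v : S → ℝ) (π : S → A) : S → ℝ :=
  fun s => (Finset.univ.sup' Finset.univ_nonempty fun π' : S → A => bOp P γ r π' v s)
    - bOp P γ r π v s

/-- Values of the PSDP∞ non-stationary policies: `vSig P γ r πseq k = v_{σ_k}
= T_{π_k} T_{π_{k-1}} ⋯ T_{π_1} r` (so `vSig P γ r πseq 0 = r`). -/
def vSig {S A : Type*} [Fintype S] (P : S → A → S → ℝ) (γ : ℝ) (r : S → ℝ)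
    (πseq : ℕ → S → A) : ℕ → S → ℝ
  | 0 => r
  | k+1 => bOp P γ r (πseq (k+1)) (vSig P γ r πseq k)


/-- The composed NSPI operator
`nsRun P γ r πseq j m v = T_{π_j} T_{π_{j−1}} ⋯ T_{π_{j−m+1}} v` (identity for `m = 0`). -/
def nsRun {S A : Type*} [Fintype S] (P : S → A → S → ℝ) (γ : ℝ) (r : S → ℝ)
    (πseq : ℤ → S → A) : ℤ → ℕ → (S → ℝ) → (S → ℝ)
  | _, 0, v => v
  | j, m+1, v => bOp P γ r (πseq j) (nsRun P γ r πseq (j-1) m v)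

/-- `gamMat P γ πseq j m = Γ_{j,m} = (γP_{π_j})(γP_{π_{j−1}})⋯(γP_{π_{j−m+1}})`. -/
def gamMat {S A : Type*} [Fintype S] [DecidableEq S]
    (P : S → A → S → ℝ) (γ : ℝ) (πseq : ℤ → S → A) (j : ℤ) (m : ℕ) : Matrix S S ℝ :=
  ((List.range m).map fun i => γ • polMat P (πseq (j - (i : ℤ)))).prod

section Stochastic

variable {S : Type*} [Fintype S]

lemma dotProduct_le_dotProduct_left_of_nonneg {w x y : S → ℝ} (hw : 0 ≤ w) (h : x ≤ y) :
    w ⬝ᵥ x ≤ w ⬝ᵥ y :=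
  Finset.sum_le_sum fun s _ => mul_le_mul_of_nonneg_left (h s) (hw s)

/-- A distribution averages any function to at most an upper bound of it. -/
lemma dotProduct_le_of_le_const {w x : S → ℝ} (hw : 0 ≤ w) (hw1 : ∑ s, w s = 1) {b : ℝ}
    (hx : ∀ s, x s ≤ b) : w ⬝ᵥ x ≤ b := by
  calc w ⬝ᵥ x ≤ ∑ s, w s * b :=
        Finset.sum_le_sum fun s _ => mul_le_mul_of_nonneg_left (hx s) (hw s)
    _ = b := by rw [← Finset.sum_mul, hw1, one_mul]

variable [DecidableEq S]

lemma vecMul_nonneg_of_mem_rowStochastic {M : Matrix S S ℝ} (hM : M ∈ rowStochastic ℝ S)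
    {w : S → ℝ} (hw : 0 ≤ w) : 0 ≤ w ᵥ* M :=
  nonneg_vecMul_of_mem_rowStochastic hM hw

lemma sum_vecMul_of_mem_rowStochastic {M : Matrix S S ℝ} (hM : M ∈ rowStochastic ℝ S)
    (w : S → ℝ) : ∑ s, (w ᵥ* M) s = ∑ s, w s := by
  rw [← dotProduct_one, ← dotProduct_one, ← dotProduct_mulVec, hM.2]

/-- Maximum principle for a strictly discounted stochastic matrix. -/
lemma nonneg_of_smul_mulVec_le {M : Matrix S S ℝ} (hM : M ∈ rowStochastic ℝ S)
    {g : ℝ} (hg0 : 0 ≤ g) (hg1 : g < 1) {x : S → ℝ} (h : g • (M *ᵥ x) ≤ x) : 0 ≤ x := by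
  intro s₀
  have : Nonempty S := ⟨s₀⟩
  obtain ⟨s, hs⟩ := Finite.exists_min x
  have h1 : x s ≤ (M *ᵥ x) s := by
    calc x s = ∑ s', M s s' * x s := by
          rw [← Finset.sum_mul, sum_row_of_mem_rowStochastic hM, one_mul]
      _ ≤ ∑ s', M s s' * x s' :=
          Finset.sum_le_sum fun s' _ => mul_le_mul_of_nonneg_left (hs s') (hM.1 s s')
  have h2 : g * (M *ᵥ x) s ≤ x s := h s
  have h3 : g * x s ≤ g * (M *ᵥ x) s := mul_le_mul_of_nonneg_left h1 hg0
  have h4 : 0 ≤ x s := by nlinarith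
  exact h4.trans (hs s₀)

/-- Unrolling of the affine recursive inequality `x (j+1) ≤ g M x j + f (j+1)`, integrated against
a nonnegative weight. -/
lemma dotProduct_le_sum_of_le_smul_mulVec_add {M : Matrix S S ℝ} (hM : M ∈ rowStochastic ℝ S)
    {g : ℝ} (hg : 0 ≤ g) (x f : ℕ → S → ℝ) (k : ℕ)
    (h : ∀ j < k, x (j + 1) ≤ g • (M *ᵥ x j) + f (j + 1)) {w : S → ℝ} (hw : 0 ≤ w) :
    w ⬝ᵥ x k ≤ ∑ i ∈ Finset.range k, g ^ i * ((w ᵥ* M ^ i) ⬝ᵥ f (k - i))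
      + g ^ k * ((w ᵥ* M ^ k) ⬝ᵥ x 0) := by
  induction k generalizing w with
  | zero => simp
  | succ k ih =>
    have ih' := ih (fun j hj => h j (by omega)) (vecMul_nonneg_of_mem_rowStochastic hM hw)
    have hstep := dotProduct_le_dotProduct_left_of_nonneg hw (h k (by omega))
    rw [dotProduct_add, dotProduct_smul, smul_eq_mul, dotProduct_mulVec] at hstep
    have hmul := mul_le_mul_of_nonneg_left ih' hg
    rw [mul_add, Finset.mul_sum] at hmul
    simp only [vecMul_vecMul, ← pow_succ', ← mul_assoc] at hmul
    rw [Finset.sum_range_succ']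
    simp only [Nat.add_sub_add_right, pow_zero, vecMul_one, one_mul, Nat.sub_zero]
    linarith

/-- Resolvent bound: `D ≤ g M (e + D)` gives `w D ≤ ∑_{l ≥ 1} g^l w M^l e`, truncated. -/
lemma dotProduct_le_sum_of_le_smul_mulVec {M : Matrix S S ℝ} (hM : M ∈ rowStochastic ℝ S)
    {g : ℝ} (hg : 0 ≤ g) {D e : S → ℝ} (h : D ≤ g • (M *ᵥ (e + D))) (N : ℕ)
    {w : S → ℝ} (hw : 0 ≤ w) :
    w ⬝ᵥ D ≤ ∑ l ∈ Finset.range N, g ^ (l + 1) * ((w ᵥ* M ^ (l + 1)) ⬝ᵥ e)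
      + g ^ N * ((w ᵥ* M ^ N) ⬝ᵥ D) := by
  have h' : D ≤ g • (M *ᵥ D) + g • (M *ᵥ e) := by
    rwa [mulVec_add, smul_add, add_comm] at h
  refine (dotProduct_le_sum_of_le_smul_mulVec_add hM hg (fun _ => D)
    (fun _ => g • (M *ᵥ e)) N (fun _ _ => h') hw).trans_eq ?_
  congr 1
  refine Finset.sum_congr rfl fun l _ => ?_
  rw [dotProduct_smul, smul_eq_mul, dotProduct_mulVec, vecMul_vecMul, ← pow_succ]
  ring

end Stochastic

section Policies

variable {S A : Type*}

/-- The list of policies `π_j, π_{j−1}, …, π_{j−m+1}` played in one loop of NSPI. -/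
def loopPols (πseq : ℤ → S → A) : ℤ → ℕ → List (S → A)
  | _, 0 => []
  | j, m + 1 => πseq j :: loopPols πseq (j - 1) m

lemma length_loopPols (πseq : ℤ → S → A) (j : ℤ) (m : ℕ) :
    (loopPols πseq j m).length = m := by
  induction m generalizing j with
  | zero => rfl
  | succ m ih => simp [loopPols, ih]

variable [Fintype S]

lemma bOp_eq (P : S → A → S → ℝ) (γ : ℝ) (r : S → ℝ) (π : S → A) (v : S → ℝ) :
    bOp P γ r π v = r + γ • (polMat P π *ᵥ v) := rfl

lemma bOp_sub (P : S → A → S → ℝ) (γ : ℝ) (r : S → ℝ) (π : S → A) (u v : S → ℝ) :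
    bOp P γ r π u - bOp P γ r π v = γ • (polMat P π *ᵥ (u - v)) := by
  rw [bOp_eq, bOp_eq, mulVec_sub, smul_sub, add_sub_add_left_eq_sub]

lemma nsRun_succ (P : S → A → S → ℝ) (γ : ℝ) (r : S → ℝ) (πseq : ℤ → S → A) (j : ℤ) (m : ℕ)
    (v : S → ℝ) :
    nsRun P γ r πseq j (m + 1) v = nsRun P γ r πseq j m (bOp P γ r (πseq (j - m)) v) := by
  induction m generalizing j with
  | zero => simp [nsRun]
  | succ m ih =>
    rw [nsRun, ih (j - 1), nsRun, show j - 1 - (m : ℤ) = j - ((m + 1 : ℕ) : ℤ) by push_cast; ring]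

lemma polMat_mulVec_const {P : S → A → S → ℝ} (hP1 : ∀ s a, ∑ s' : S, P s a s' = 1)
    (π : S → A) (b : ℝ) : (polMat P π *ᵥ fun _ => b) = fun _ => b := by
  funext s
  simp [mulVec, dotProduct, polMat, ← Finset.sum_mul, hP1]

variable [DecidableEq S]

lemma nsRun_sub (P : S → A → S → ℝ) (γ : ℝ) (r : S → ℝ) (πseq : ℤ → S → A) (j : ℤ) (m : ℕ)
    (u v : S → ℝ) :
    nsRun P γ r πseq j m u - nsRun P γ r πseq j m v =
      γ ^ m • (((loopPols πseq j m).map (polMat P)).prod *ᵥ (u - v)) := by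
  induction m generalizing j with
  | zero => simp [nsRun, loopPols]
  | succ m ih =>
    rw [nsRun, nsRun, bOp_sub, ih, loopPols, List.map_cons, List.prod_cons, mulVec_smul,
      smul_smul, mulVec_mulVec, pow_succ']

lemma le_bOp_add_errOf [Fintype A] [Nonempty A] (P : S → A → S → ℝ) (γ : ℝ) (r v : S → ℝ)
    (π π' : S → A) : bOp P γ r π' v ≤ bOp P γ r π v + errOf P γ r v π := by
  intro s
  have := Finset.le_sup' (fun π' : S → A => bOp P γ r π' v s) (Finset.mem_univ π')
  simp only [errOf, Pi.add_apply]
  linarith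

lemma errOf_nonneg [Fintype A] [Nonempty A] (P : S → A → S → ℝ) (γ : ℝ) (r v : S → ℝ)
    (π : S → A) : 0 ≤ errOf P γ r v π := by
  have h := le_bOp_add_errOf P γ r v π π
  simpa using h

lemma polMat_mem_rowStochastic {P : S → A → S → ℝ} (hP0 : ∀ s a s', 0 ≤ P s a s')
    (hP1 : ∀ s a, ∑ s' : S, P s a s' = 1) (π : S → A) : polMat P π ∈ rowStochastic ℝ S :=
  mem_rowStochastic_iff_sum.2 ⟨fun s s' => hP0 s (π s) s', fun s => hP1 s (π s)⟩

lemma prod_map_polMat_mem_rowStochastic {P : S → A → S → ℝ} (hP0 : ∀ s a s', 0 ≤ P s a s')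
    (hP1 : ∀ s a, ∑ s' : S, P s a s' = 1) (L : List (S → A)) :
    (L.map (polMat P)).prod ∈ rowStochastic ℝ S :=
  Submonoid.list_prod_mem _ fun _ hM => by
    obtain ⟨π, -, rfl⟩ := List.mem_map.1 hM
    exact polMat_mem_rowStochastic hP0 hP1 π

/-- A fixed point of a discounted Bellman operator is at most `Rmax / (1 - γ)`. -/
lemma le_of_bOp_eq_self {P : S → A → S → ℝ} (hP0 : ∀ s a s', 0 ≤ P s a s')
    (hP1 : ∀ s a, ∑ s' : S, P s a s' = 1) {γ : ℝ} (hγ0 : 0 ≤ γ) (hγ1 : γ < 1)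
    {r : S → ℝ} {Rmax b : ℝ} (hr : ∀ s, r s ≤ Rmax) (hb : Rmax + γ * b = b)
    {π : S → A} {v : S → ℝ} (hv : bOp P γ r π v = v) (s : S) : v s ≤ b := by
  have h : 0 ≤ (fun _ => b) - v := by
    refine nonneg_of_smul_mulVec_le (polMat_mem_rowStochastic hP0 hP1 π) hγ0 hγ1 fun s => ?_
    have h1 := congrFun hv s
    rw [bOp_eq] at h1
    rw [mulVec_sub, polMat_mulVec_const hP1]
    simp only [Pi.add_apply, Pi.smul_apply, Pi.sub_apply, smul_eq_mul] at h1 ⊢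
    linarith [hr s]
  simpa using h s

lemma const_le_nsRun_const {P : S → A → S → ℝ} (hP0 : ∀ s a s', 0 ≤ P s a s')
    (hP1 : ∀ s a, ∑ s' : S, P s a s' = 1) {γ : ℝ} (hγ0 : 0 ≤ γ)
    {r : S → ℝ} {Rmax b : ℝ} (hr : ∀ s, -Rmax ≤ r s) (hb : Rmax + γ * b = b)
    (πseq : ℤ → S → A) (j : ℤ) (m : ℕ) :
    (fun _ => -b) ≤ nsRun P γ r πseq j m fun _ => -b := by
  induction m generalizing j with
  | zero => exact le_rfl
  | succ m ih =>
    intro s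
    have h1 : -b ≤ (polMat P (πseq j) *ᵥ nsRun P γ r πseq (j - 1) m fun _ => -b) s := by
      have h2 := nonneg_mulVec_of_mem_rowStochastic (polMat_mem_rowStochastic hP0 hP1 (πseq j))
        (x := (nsRun P γ r πseq (j - 1) m fun _ => -b) - fun _ => -b)
        (fun s => sub_nonneg.2 (ih (j - 1) s)) s
      rw [mulVec_sub, polMat_mulVec_const hP1] at h2
      exact sub_nonneg.1 h2
    have h3 := mul_le_mul_of_nonneg_left h1 hγ0
    rw [nsRun, bOp_eq]
    simp only [Pi.add_apply, Pi.smul_apply, smul_eq_mul]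
    linarith [hr s]

/-- The value of a periodic policy is at least `-Rmax / (1 - γ)`. -/
lemma neg_le_of_nsRun_eq_self {P : S → A → S → ℝ} (hP0 : ∀ s a s', 0 ≤ P s a s')
    (hP1 : ∀ s a, ∑ s' : S, P s a s' = 1) {γ : ℝ} (hγ0 : 0 ≤ γ) (hγ1 : γ < 1)
    {r : S → ℝ} {Rmax b : ℝ} (hr : ∀ s, -Rmax ≤ r s) (hb : Rmax + γ * b = b)
    {πseq : ℤ → S → A} {j : ℤ} {m : ℕ} (hm : m ≠ 0) {v : S → ℝ}
    (hv : nsRun P γ r πseq j m v = v) (s : S) : -b ≤ v s := by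
  have h : 0 ≤ v - fun _ => -b := by
    refine nonneg_of_smul_mulVec_le
      (prod_map_polMat_mem_rowStochastic hP0 hP1 (loopPols πseq j m)) (pow_nonneg hγ0 m)
      (pow_lt_one₀ hγ0 hγ1 hm) ?_
    rw [← nsRun_sub P γ r, hv]
    exact sub_le_sub_left (const_le_nsRun_const hP0 hP1 hγ0 hr hb πseq j m) v
  exact sub_nonneg.1 (h s)

/-- One NSPI step: the gap `D` between `T_{π_{j+1}} v_j` and `v_{j+1}` satisfies
`D ≤ Γ_{j+1,m} (e_{j+1} + D)`. -/
lemma bOp_sub_le_of_nsRun_eq_self [Fintype A] [Nonempty A] {P : S → A → S → ℝ}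
    (hP0 : ∀ s a s', 0 ≤ P s a s') (hP1 : ∀ s a, ∑ s' : S, P s a s' = 1) {γ : ℝ} (hγ0 : 0 ≤ γ)
    {r : S → ℝ} {πseq : ℤ → S → A} {j : ℤ} {m : ℕ} {u v : S → ℝ}
    (hu : nsRun P γ r πseq (j - 1) m u = u) (hv : nsRun P γ r πseq j m v = v) :
    bOp P γ r (πseq j) u - v ≤ γ ^ m • (((loopPols πseq j m).map (polMat P)).prod *ᵥ
      (errOf P γ r u (πseq j) + (bOp P γ r (πseq j) u - v))) := by
  have h1 : bOp P γ r (πseq j) u = nsRun P γ r πseq j m (bOp P γ r (πseq (j - m)) u) := by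
    rw [← nsRun_succ, nsRun, hu]
  have h2 : bOp P γ r (πseq j) u - v = γ ^ m • (((loopPols πseq j m).map (polMat P)).prod *ᵥ
      (bOp P γ r (πseq (j - m)) u - v)) := by
    rw [← nsRun_sub P γ r, hv, ← h1]
  have h3 := le_bOp_add_errOf P γ r u (πseq j) (πseq (j - m))
  have h4 := nonneg_mulVec_of_mem_rowStochastic
    (prod_map_polMat_mem_rowStochastic hP0 hP1 (loopPols πseq j m))
    (x := (errOf P γ r u (πseq j) + (bOp P γ r (πseq j) u - v)) -
      (bOp P γ r (πseq (j - m)) u - v)) (fun s => by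
        have := h3 s
        simp only [Pi.add_apply, Pi.sub_apply] at this ⊢
        linarith)
  intro s
  have h5 := h4 s
  rw [mulVec_sub] at h5
  refine (congrFun h2 s).trans_le ?_
  exact mul_le_mul_of_nonneg_left (sub_nonneg.1 h5) (pow_nonneg hγ0 m)

lemma vecMul_prod_map_polMat_le {P : S → A → S → ℝ} [Nonempty A] {μ ν : S → ℝ} {c : ℕ → ℝ}
    (hc : ∀ (i : ℕ) (πs : ℕ → S → A) (s : S),
      (μ ᵥ* ((List.range i).map fun t => polMat P (πs t)).prod) s ≤ c i * ν s)
    (L : List (S → A)) : μ ᵥ* (L.map (polMat P)).prod ≤ c L.length • ν := by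
  intro s
  have h : (List.range L.length).map (fun t => polMat P (L.getD t (Classical.arbitrary _))) =
      L.map (polMat P) := by
    refine List.ext_getElem (by simp) fun n h1 h2 => ?_
    have hn : n < L.length := by simpa using h1
    simp [hn]
  have := hc L.length (fun t => L.getD t (Classical.arbitrary _)) s
  rwa [h] at this

/-- Concentrability along `i` steps of one policy followed by `l` loops of length `m`. -/
lemma vecMul_pow_vecMul_pow_le {P : S → A → S → ℝ} [Nonempty A] {μ ν : S → ℝ} {c : ℕ → ℝ}
    (hc : ∀ (i : ℕ) (πs : ℕ → S → A) (s : S),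
      (μ ᵥ* ((List.range i).map fun t => polMat P (πs t)).prod) s ≤ c i * ν s)
    (π : S → A) (L : List (S → A)) (i l : ℕ) :
    μ ᵥ* polMat P π ^ i ᵥ* (L.map (polMat P)).prod ^ l ≤ c (i + l * L.length) • ν := by
  have h := vecMul_prod_map_polMat_le hc (List.replicate i π ++ (List.replicate l L).flatten)
  simpa [vecMul_vecMul, List.map_flatten, List.prod_flatten] using h

end Policies

/-- for NSPI(m), if `ν e_j ≤ ε` for `1 ≤ j ≤ k` and the double series
`Σ_{i,j≥0} γ^{i+jm} c(i+(j+1)m)` converges, then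
`μ(v_{π*} − v_{k,m}) ≤ (Σ_{i=0}^{k−1} γ^i c_{π*}(i)) ε
  + γ^m (Σ_{i,j≥0} γ^{i+jm} c(i+(j+1)m)) ε + 2 γ^k Vmax`. -/
theorem stmt8
    {S A : Type*} [Fintype S] [Fintype A] [DecidableEq S] [Nonempty S] [Nonempty A]
    (P : S → A → S → ℝ) (hP0 : ∀ s a s', 0 ≤ P s a s')
    (hP1 : ∀ s a, ∑ s' : S, P s a s' = 1)
    (γ : ℝ) (hγ0 : 0 < γ) (hγ1 : γ < 1)
    (Rmax Vmax : ℝ) (r : S → ℝ) (hr : ∀ s, |r s| ≤ Rmax)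
    (hVmax : Vmax = Rmax / (1 - γ))
    (πstar : S → A) (vstar : S → ℝ)
    (hfix : bOp P γ r πstar vstar = vstar)
    (hopt : ∀ (π : S → A) (v : S → ℝ), bOp P γ r π v = v → ∀ s, v s ≤ vstar s)
    (μ ν : S → ℝ) (hμ0 : ∀ s, 0 ≤ μ s) (hμ1 : ∑ s : S, μ s = 1)
    (hν0 : ∀ s, 0 ≤ ν s) (hν1 : ∑ s : S, ν s = 1)
    (c : ℕ → ℝ) (hc0 : ∀ i, 0 ≤ c i)
    (hc : ∀ (i : ℕ) (πs : ℕ → S → A) (s : S),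
      Matrix.vecMul μ (((List.range i).map fun t => polMat P (πs t)).prod) s ≤ c i * ν s)
    (cπ : ℕ → ℝ) (hcπ0 : ∀ i, 0 ≤ cπ i)
    (hcπ : ∀ (i : ℕ) (s : S), Matrix.vecMul μ ((polMat P πstar) ^ i) s ≤ cπ i * ν s)
    (m : ℕ) (hm : 1 ≤ m) (πseq : ℤ → S → A)
    (vN : ℕ → S → ℝ)
    (hvN : ∀ j : ℕ, nsRun P γ r πseq (j : ℤ) m (vN j) = vN j)
    (k : ℕ) (hk : 1 ≤ k)
    (ε : ℝ) (hε : 0 ≤ ε)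
    (herr : ∀ j, 1 ≤ j → j ≤ k →
      (∑ s : S, ν s * errOf P γ r (vN (j - 1)) (πseq (j : ℤ)) s) ≤ ε)
    (hsum : Summable fun p : ℕ × ℕ => γ ^ (p.1 + p.2 * m) * c (p.1 + (p.2 + 1) * m)) :
    (∑ s : S, μ s * (vstar s - vN k s)) ≤
      (∑ i ∈ Finset.range k, γ ^ i * cπ i) * ε
        + γ ^ m * (∑' p : ℕ × ℕ, γ ^ (p.1 + p.2 * m) * c (p.1 + (p.2 + 1) * m)) * ε
        + 2 * γ ^ k * Vmax := by
  have hb : Rmax + γ * Vmax = Vmax := by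
    rw [hVmax]
    field_simp [(sub_pos.2 hγ1).ne']
    ring
  set Q := polMat P πstar
  have hQ : Q ∈ rowStochastic ℝ S := polMat_mem_rowStochastic hP0 hP1 πstar
  let e : ℕ → S → ℝ := fun j => errOf P γ r (vN (j - 1)) (πseq j)
  let D : ℕ → S → ℝ := fun j => bOp P γ r (πseq j) (vN (j - 1)) - vN j
  let W : ℕ → Matrix S S ℝ := fun j => ((loopPols πseq j m).map (polMat P)).prod
  have hW (j : ℕ) : W j ∈ rowStochastic ℝ S := prod_map_polMat_mem_rowStochastic hP0 hP1 _
  have he0 (j : ℕ) : 0 ≤ e j := errOf_nonneg P γ r _ _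
  have hD (j : ℕ) (hj : 1 ≤ j) : D j ≤ γ ^ m • (W j *ᵥ (e j + D j)) := by
    refine bOp_sub_le_of_nsRun_eq_self hP0 hP1 hγ0.le ?_ (hvN j)
    have := hvN (j - 1)
    rwa [Nat.cast_sub hj, Nat.cast_one] at this
  have hrec (j : ℕ) :
      vstar - vN (j + 1) ≤ γ • (Q *ᵥ (vstar - vN j)) + (e (j + 1) + D (j + 1)) := by
    rw [← bOp_sub P γ r, hfix]
    intro s
    have := le_bOp_add_errOf P γ r (vN j) (πseq (j + 1 : ℕ)) πstar s
    simp only [e, D, Pi.add_apply, Pi.sub_apply, Nat.add_sub_cancel] at this ⊢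
    linarith
  have hμ : 0 ≤ μ := hμ0
  have hw (i : ℕ) : 0 ≤ μ ᵥ* Q ^ i := vecMul_nonneg_of_mem_rowStochastic (pow_mem hQ i) hμ
  have hw1 (i : ℕ) : ∑ s, (μ ᵥ* Q ^ i) s = 1 := by
    rw [sum_vecMul_of_mem_rowStochastic (pow_mem hQ i), hμ1]
  have herr_le {w : S → ℝ} {a : ℝ} (ha : 0 ≤ a) (hwa : w ≤ a • ν) {j : ℕ} (h1 : 1 ≤ j)
      (hj : j ≤ k) : w ⬝ᵥ e j ≤ a * ε := by
    calc w ⬝ᵥ e j ≤ (a • ν) ⬝ᵥ e j :=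
          Finset.sum_le_sum fun s _ => mul_le_mul_of_nonneg_right (hwa s) (he0 j s)
      _ = a * (ν ⬝ᵥ e j) := by rw [smul_dotProduct, smul_eq_mul]
      _ ≤ a * ε := mul_le_mul_of_nonneg_left (herr j h1 hj) ha
  let F : ℕ × ℕ → ℝ := fun p => γ ^ (p.1 + p.2 * m) * c (p.1 + (p.2 + 1) * m)
  let b : ℕ → ℝ := fun j => ∑ s, |D j s|
  have hDterm (N i : ℕ) (hi : i < k) : γ ^ i * ((μ ᵥ* Q ^ i) ⬝ᵥ D (k - i)) ≤
      γ ^ m * (∑ l ∈ Finset.range N, F (i, l)) * ε + (γ ^ m) ^ N * (γ ^ i * b (k - i)) := by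
    have h1 := dotProduct_le_sum_of_le_smul_mulVec (hW (k - i)) (pow_nonneg hγ0.le m)
      (hD (k - i) (by omega)) N (hw i)
    have h2 : ((μ ᵥ* Q ^ i) ᵥ* W (k - i) ^ N) ⬝ᵥ D (k - i) ≤ b (k - i) := by
      refine dotProduct_le_of_le_const
        (vecMul_nonneg_of_mem_rowStochastic (pow_mem (hW _) N) (hw i)) ?_ fun s => ?_
      · rw [sum_vecMul_of_mem_rowStochastic (pow_mem (hW _) N), hw1]
      · exact (le_abs_self _).trans
          (Finset.single_le_sum (f := fun s => |D (k - i) s|) (fun _ _ => abs_nonneg _)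
            (Finset.mem_univ s))
    have h3 (l : ℕ) : ((μ ᵥ* Q ^ i) ᵥ* W (k - i) ^ (l + 1)) ⬝ᵥ e (k - i) ≤
        c (i + (l + 1) * m) * ε := by
      refine herr_le (hc0 _) ?_ (by omega) (by omega)
      have := vecMul_pow_vecMul_pow_le hc πstar (loopPols πseq (k - i : ℕ) m) i (l + 1)
      rwa [length_loopPols] at this
    calc γ ^ i * ((μ ᵥ* Q ^ i) ⬝ᵥ D (k - i))
        ≤ γ ^ i * (∑ l ∈ Finset.range N, (γ ^ m) ^ (l + 1) * (c (i + (l + 1) * m) * ε)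
            + (γ ^ m) ^ N * b (k - i)) := by
          refine mul_le_mul_of_nonneg_left (h1.trans ?_) (pow_nonneg hγ0.le i)
          gcongr with l _
          exact h3 l
      _ = _ := by
          simp only [F, Finset.mul_sum, Finset.sum_mul, mul_add]
          congr 1
          · refine Finset.sum_congr rfl fun l _ => ?_
            ring
          · ring
  have heterm (i : ℕ) (hi : i < k) :
      γ ^ i * ((μ ᵥ* Q ^ i) ⬝ᵥ e (k - i)) ≤ γ ^ i * cπ i * ε := by
    rw [mul_assoc]
    exact mul_le_mul_of_nonneg_left (herr_le (hcπ0 i) (hcπ i) (by omega) (by omega))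
      (pow_nonneg hγ0.le i)
  have hlast : (μ ᵥ* Q ^ k) ⬝ᵥ (vstar - vN 0) ≤ 2 * Vmax := by
    refine dotProduct_le_of_le_const (hw k) (hw1 k) fun s => ?_
    have h1 := le_of_bOp_eq_self hP0 hP1 hγ0.le hγ1 (fun s => (abs_le.1 (hr s)).2) hb hfix s
    have h2 := neg_le_of_nsRun_eq_self hP0 hP1 hγ0.le hγ1 (fun s => (abs_le.1 (hr s)).1) hb
      (by omega) (hvN 0) s
    simp only [Pi.sub_apply]
    linarith
  have hF0 (p : ℕ × ℕ) : 0 ≤ F p := mul_nonneg (pow_nonneg hγ0.le _) (hc0 _)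
  have hmain (N : ℕ) : μ ⬝ᵥ (vstar - vN k) ≤
      (∑ i ∈ Finset.range k, γ ^ i * cπ i) * ε + γ ^ m * (∑' p, F p) * ε + 2 * γ ^ k * Vmax
        + (γ ^ m) ^ N * ∑ i ∈ Finset.range k, γ ^ i * b (k - i) := by
    have h1 := dotProduct_le_sum_of_le_smul_mulVec_add hQ hγ0.le (fun j => vstar - vN j)
      (fun j => e j + D j) k (fun j _ => hrec j) hμ
    have h2 : ∑ i ∈ Finset.range k, γ ^ i * ((μ ᵥ* Q ^ i) ⬝ᵥ (e (k - i) + D (k - i))) ≤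
        ∑ i ∈ Finset.range k, (γ ^ i * cπ i * ε +
          (γ ^ m * (∑ l ∈ Finset.range N, F (i, l)) * ε + (γ ^ m) ^ N * (γ ^ i * b (k - i)))) :=
      Finset.sum_le_sum fun i hi => by
        rw [dotProduct_add, mul_add]
        exact add_le_add (heterm i (Finset.mem_range.1 hi)) (hDterm N i (Finset.mem_range.1 hi))
    rw [Finset.sum_add_distrib, Finset.sum_add_distrib, ← Finset.sum_mul, ← Finset.sum_mul,
      ← Finset.mul_sum, ← Finset.mul_sum, ← Finset.sum_product'] at h2
    have h3 : γ ^ m * (∑ p ∈ Finset.range k ×ˢ Finset.range N, F p) * ε ≤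
        γ ^ m * (∑' p, F p) * ε := by
      gcongr
      exact hsum.sum_le_tsum _ fun p _ => hF0 p
    have h4 := mul_le_mul_of_nonneg_left hlast (pow_nonneg hγ0.le k)
    linarith
  have hlim : Filter.Tendsto (fun N : ℕ => (γ ^ m) ^ N * ∑ i ∈ Finset.range k, γ ^ i * b (k - i))
      Filter.atTop (nhds 0) := by
    simpa using (tendsto_pow_atTop_nhds_zero_of_lt_one (pow_nonneg hγ0.le m)
      (pow_lt_one₀ hγ0.le hγ1 (by omega))).mul_const (∑ i ∈ Finset.range k, γ ^ i * b (k - i))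
  refine ge_of_tendsto' (by simpa using hlim.const_add _) hmain
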